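/- arXiv:2509.23015 — 7 statements merged into one kernel-verified Lean document; each statement's English description precedes it below -/
import Mathlib

section
/- Let π : X → Y be a continuous surjection between compact Hausdorff spaces. Then the push-forward map M(π) : M(X) → M(Y) is irreducible if and only if π is irreducible. -/
open MeasureTheory Set

/-- A map `π` is irreducible if every closed subset `A ⊆ X` with `π(A) = Y` satisfies `A = X`. -/
def IsIrreducibleMap {X Y : Type*} [TopologicalSpace X] (π : X → Y) : Prop :=
  ∀ A : Set X, IsClosed A → π '' A = Set.univ → A = Set.univ

/-- `x` is an injectivity point of `π` if `π⁻¹(π(x)) = {x}`. -/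
def IsInjectivityPoint {X Y : Type*} (π : X → Y) (x : X) : Prop :=
  π ⁻¹' {π x} = {x}

/-- `π` is almost one-to-one if its set of injectivity points is dense. -/
def IsAlmostOneToOne {X Y : Type*} [TopologicalSpace X] (π : X → Y) : Prop :=
  Dense {x : X | IsInjectivityPoint π x}

/-- `π` is semi-open if the image of every nonempty open set has nonempty interior. -/
def IsSemiOpenMap {X Y : Type*} [TopologicalSpace X] [TopologicalSpace Y] (π : X → Y) : Prop :=
  ∀ U : Set X, IsOpen U → U.Nonempty → (interior (π '' U)).Nonempty

/-- The push-forward map `M(π) : M(X) → M(Y)` on spaces of Borel probability measures. -/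
noncomputable def pushforwardMap {X Y : Type*} [TopologicalSpace X] [TopologicalSpace Y]
    [MeasurableSpace X] [BorelSpace X] [MeasurableSpace Y] [BorelSpace Y]
    {π : X → Y} (hc : Continuous π) :
    ProbabilityMeasure X → ProbabilityMeasure Y :=
  fun μ => μ.map hc.measurable.aemeasurable

open Filter Topology
open scoped ENNReal

/-- A normalized monotone supermodular set function, inner regular with respect to `𝒦`. -/
structure IsInnerSupermodular {α : Type*} (𝒦 : Set (Set α)) (φ : Set α → ℝ) : Prop where
  mono : Monotone φ
  empty : φ ∅ = 0
  univ : φ Set.univ = 1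
  supermodular : ∀ s t, φ s + φ t ≤ φ (s ∪ t) + φ (s ∩ t)
  inner : ∀ s, ∀ ε > 0, ∃ K ∈ 𝒦, K ⊆ s ∧ φ s < φ K + ε

namespace IsInnerSupermodular

variable {α : Type*} {𝒦 : Set (Set α)} {φ : Set α → ℝ}

lemma nonneg (h : IsInnerSupermodular 𝒦 φ) (s : Set α) : 0 ≤ φ s :=
  h.empty ▸ h.mono (empty_subset s)

lemma le_one (h : IsInnerSupermodular 𝒦 φ) (s : Set α) : φ s ≤ 1 :=
  h.univ ▸ h.mono (subset_univ s)

lemma add_compl_le (h : IsInnerSupermodular 𝒦 φ) (s : Set α) : φ s + φ sᶜ ≤ 1 := by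
  simpa [h.empty, h.univ] using h.supermodular s sᶜ

/-- Modify `φ` so that the complement of `K` keeps its mass and `K` receives the rest. -/
lemma concentrate (h : IsInnerSupermodular 𝒦 φ) (hsup : SupClosed 𝒦) (hinf : InfClosed 𝒦)
    {K : Set α} (hK : K ∈ 𝒦) :
    IsInnerSupermodular 𝒦 (fun s ↦ φ (s ∩ Kᶜ) + φ (s ∪ Kᶜ) - φ Kᶜ) where
  mono s t hst := by
    have h₁ := h.mono (inter_subset_inter_left Kᶜ hst)
    have h₂ := h.mono (union_subset_union_left Kᶜ hst)
    simp only
    linarith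
  empty := by simp [h.empty]
  univ := by simp [h.univ]
  supermodular s t := by
    have h₁ := h.supermodular (s ∩ Kᶜ) (t ∩ Kᶜ)
    have h₂ := h.supermodular (s ∪ Kᶜ) (t ∪ Kᶜ)
    rw [← union_inter_distrib_right, ← inter_inter_distrib_right] at h₁
    rw [← inter_union_distrib_right, ← union_union_distrib_right] at h₂
    linarith
  inner s ε hε := by
    obtain ⟨L, hL, hLs, hφL⟩ := h.inner (s ∩ Kᶜ) (ε / 2) (half_pos hε)
    obtain ⟨M, hM, hMs, hφM⟩ := h.inner (s ∪ Kᶜ) (ε / 2) (half_pos hε)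
    refine ⟨L ∪ M ∩ K, hsup hL (hinf hM hK), ?_, ?_⟩
    · rintro x (hx | ⟨hx, hxK⟩)
      · exact (hLs hx).1
      · exact (hMs hx).resolve_right fun hc ↦ hc hxK
    · have h₁ : φ L ≤ φ ((L ∪ M ∩ K) ∩ Kᶜ) :=
        h.mono fun x hx ↦ ⟨Or.inl hx, (hLs hx).2⟩
      have h₂ : φ M ≤ φ ((L ∪ M ∩ K) ∪ Kᶜ) := h.mono fun x hx ↦ by
        by_cases hxK : x ∈ K
        · exact Or.inl (Or.inr ⟨hx, hxK⟩)
        · exact Or.inr hxK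
      linarith

lemma sSup_chain {c : Set (Set α → ℝ)} (hc : ∀ φ ∈ c, IsInnerSupermodular 𝒦 φ)
    (hchain : IsChain (· ≤ ·) c) (hne : c.Nonempty) :
    ∃ ψ, IsInnerSupermodular 𝒦 ψ ∧ ∀ φ ∈ c, φ ≤ ψ := by
  have : Nonempty c := hne.to_subtype
  have hbdd (s : Set α) : BddAbove (range fun φ : c ↦ φ.1 s) :=
    ⟨1, by rintro _ ⟨φ, rfl⟩; exact (hc _ φ.2).le_one s⟩
  have hle (φ : c) (s : Set α) : φ.1 s ≤ ⨆ ψ : c, ψ.1 s := le_ciSup (hbdd s) φ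
  have happrox (s : Set α) {ε : ℝ} (hε : 0 < ε) : ∃ φ : c, (⨆ ψ : c, ψ.1 s) < φ.1 s + ε := by
    obtain ⟨φ, hφ⟩ := exists_lt_of_lt_ciSup (sub_lt_self (⨆ ψ : c, ψ.1 s) hε)
    exact ⟨φ, by linarith⟩
  refine ⟨fun s ↦ ⨆ φ : c, φ.1 s, ⟨?_, ?_, ?_, ?_, ?_⟩, fun φ hφ s ↦ hle ⟨φ, hφ⟩ s⟩
  · exact fun s t hst ↦ ciSup_mono (hbdd t) fun φ ↦ (hc _ φ.2).mono hst
  · simp [fun φ : c ↦ (hc _ φ.2).empty]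
  · simp [fun φ : c ↦ (hc _ φ.2).univ]
  · intro s t
    refine le_of_forall_pos_le_add fun ε hε ↦ ?_
    obtain ⟨φ₁, h₁⟩ := happrox s (half_pos hε)
    obtain ⟨φ₂, h₂⟩ := happrox t (half_pos hε)
    obtain ⟨ψ, h₁ψ, h₂ψ⟩ : ∃ ψ : c, φ₁.1 ≤ ψ.1 ∧ φ₂.1 ≤ ψ.1 := by
      rcases hchain.total φ₁.2 φ₂.2 with h | h
      · exact ⟨φ₂, h, le_rfl⟩
      · exact ⟨φ₁, le_rfl, h⟩
    linarith [h₁ψ s, h₂ψ t, (hc _ ψ.2).supermodular s t, hle ψ (s ∪ t), hle ψ (s ∩ t)]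
  · intro s ε hε
    obtain ⟨φ, h₁⟩ := happrox s (half_pos hε)
    obtain ⟨K, hK, hKs, h₂⟩ := (hc _ φ.2).inner s _ (half_pos hε)
    exact ⟨K, hK, hKs, by linarith [hle φ K]⟩

lemma exists_ge_forall_add_compl (h : IsInnerSupermodular 𝒦 φ) (hsup : SupClosed 𝒦)
    (hinf : InfClosed 𝒦) :
    ∃ ψ, IsInnerSupermodular 𝒦 ψ ∧ φ ≤ ψ ∧ ∀ K ∈ 𝒦, ψ K + ψ Kᶜ = 1 := by
  obtain ⟨ψ, hφψ, hψ⟩ := zorn_le_nonempty₀ {ψ | IsInnerSupermodular 𝒦 ψ}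
    (fun c hc hchain y hy ↦ sSup_chain hc hchain ⟨y, hy⟩) φ h
  refine ⟨ψ, hψ.prop, hφψ, fun K hK ↦ ?_⟩
  have h₁ := hψ.le_of_ge (hψ.prop.concentrate hsup hinf hK) (fun s ↦ by
    have := hψ.prop.supermodular s Kᶜ
    simp only
    linarith) K
  simp only [inter_compl_self, union_compl_self, hψ.prop.empty, hψ.prop.univ] at h₁
  linarith [hψ.prop.add_compl_le K]

lemma modular (h : IsInnerSupermodular 𝒦 φ) {s t : Set α} (hs : φ s + φ sᶜ = 1)
    (ht : φ t + φ tᶜ = 1) :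
    φ (s ∪ t) + φ (s ∪ t)ᶜ = 1 ∧ φ (s ∪ t) + φ (s ∩ t) = φ s + φ t := by
  have h₁ := h.supermodular s t
  have h₂ := h.supermodular sᶜ tᶜ
  rw [← compl_inter, ← compl_union] at h₂
  have h₃ := h.add_compl_le (s ∪ t)
  have h₄ := h.add_compl_le (s ∩ t)
  constructor <;> linarith

lemma isSetRing (h : IsInnerSupermodular 𝒦 φ) : IsSetRing {s | φ s + φ sᶜ = 1} where
  empty_mem := by simp [h.empty, h.univ]
  union_mem s t hs ht := (h.modular hs ht).1
  sdiff_mem s t hs ht := by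
    have hs' : φ sᶜ + φ sᶜᶜ = 1 := by rw [compl_compl, add_comm]; exact hs
    have h₁ := (h.modular hs' ht).1
    rw [add_comm, compl_union, compl_compl, ← sdiff_eq] at h₁
    change φ (s \ t) + φ (s \ t)ᶜ = 1
    rwa [sdiff_eq, compl_inter, compl_compl, ← sdiff_eq]

lemma tendsto_zero (h : IsInnerSupermodular 𝒦 φ) (hinf : InfClosed 𝒦)
    (hφ : ∀ L : ℕ → Set α, (∀ n, L n ∈ 𝒦) → Antitone L → ⋂ n, L n = ∅ →
      Tendsto (fun n ↦ φ (L n)) atTop (𝓝 0))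
    {s : ℕ → Set α} (hs : Antitone s) (hs₀ : ⋂ n, s n = ∅) :
    Tendsto (fun n ↦ φ (s n)) atTop (𝓝 0) := by
  refine Metric.tendsto_atTop.2 fun ε hε ↦ ?_
  have hpos (n : ℕ) : 0 < ε / 2 / 2 ^ (n + 1) := by positivity
  choose K hK hKs hφK using fun n ↦ h.inner (s n) _ (hpos n)
  let L : ℕ → Set α := fun n ↦ Nat.rec (K 0) (fun n t ↦ t ∩ K (n + 1)) n
  have hL (n : ℕ) : L n ∈ 𝒦 := by
    induction n with
    | zero => exact hK 0
    | succ n ih => exact hinf ih (hK _)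
  have hLs (n : ℕ) : L n ⊆ s n := by
    cases n with
    | zero => exact hKs 0
    | succ n => exact inter_subset_right.trans (hKs _)
  have hLanti : Antitone L := antitone_nat_of_succ_le fun n ↦ inter_subset_left
  have hL₀ : ⋂ n, L n = ∅ := subset_empty_iff.1 (hs₀ ▸ iInter_mono hLs)
  have hφL (n : ℕ) : φ (s n) ≤ φ (L n) + ε / 2 * (1 - 1 / 2 ^ (n + 1)) := by
    induction n with
    | zero =>
      have := hφK 0
      change _ ≤ φ (K 0) + _
      norm_num at this ⊢
      linarith
    | succ n ih =>
      have h₁ := h.supermodular (L n) (K (n + 1))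
      have h₂ := h.mono (union_subset (hLs n) ((hKs (n + 1)).trans (hs n.le_succ)))
      have h₃ := hφK (n + 1)
      change _ ≤ φ (L n ∩ K (n + 1)) + _
      have h₄ : ε / 2 * (1 - 1 / 2 ^ (n + 1 + 1)) =
          ε / 2 * (1 - 1 / 2 ^ (n + 1)) + ε / 2 / 2 ^ (n + 1 + 1) := by
        field_simp
        ring
      linarith
  obtain ⟨N, hN⟩ := Metric.tendsto_atTop.1 (hφ L hL hLanti hL₀) (ε / 2) (half_pos hε)
  refine ⟨N, fun n hn ↦ ?_⟩
  have h₁ := hN n hn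
  rw [Real.dist_0_eq_abs, abs_of_nonneg (h.nonneg _)] at h₁ ⊢
  have h₂ : ε / 2 * (1 - 1 / 2 ^ (n + 1)) ≤ ε / 2 :=
    mul_le_of_le_one_right (half_pos hε).le (sub_le_self _ (by positivity))
  linarith [hφL n]

theorem exists_measure (h : IsInnerSupermodular 𝒦 φ) (hinf : InfClosed 𝒦)
    (hφ : ∀ L : ℕ → Set α, (∀ n, L n ∈ 𝒦) → Antitone L → ⋂ n, L n = ∅ →
      Tendsto (fun n ↦ φ (L n)) atTop (𝓝 0))
    [m : MeasurableSpace α] (hm : m ≤ MeasurableSpace.generateFrom {s | φ s + φ sᶜ = 1}) :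
    ∃ μ : Measure α, ∀ s, MeasurableSet s → φ s + φ sᶜ = 1 → μ s = ENNReal.ofReal (φ s) := by
  let c : AddContent ℝ≥0∞ {s | φ s + φ sᶜ = 1} :=
    h.isSetRing.addContent_of_union (fun s ↦ ENNReal.ofReal (φ s)) (by simp [h.empty])
      fun {s t} hs ht hst ↦ by
        rw [← ENNReal.ofReal_add (h.nonneg s) (h.nonneg t), ← (h.modular hs ht).2,
          hst.inter_eq, h.empty, add_zero]
  have hc : c.IsSigmaSubadditive :=
    isSigmaSubadditive_of_addContent_iUnion_eq_tsum h.isSetRing fun f hf hUf hd ↦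
      addContent_iUnion_eq_sum_of_tendsto_zero h.isSetRing c (fun _ _ ↦ ENNReal.ofReal_ne_top)
        (fun s _ hs hs₀ ↦
          ENNReal.ofReal_zero ▸ ENNReal.tendsto_ofReal (h.tendsto_zero hinf hφ hs hs₀)) hf hUf hd
  exact ⟨(@AddContent.measure _ _ (.generateFrom _) c h.isSetRing.isSetSemiring le_rfl hc).trim hm,
    fun s hsm hs ↦ (trim_measurableSet_eq hm hsm).trans
      (c.measure_eq (mα := .generateFrom _) h.isSetRing.isSetSemiring rfl hc hs)⟩

end IsInnerSupermodular

lemma measureReal_union_add_inter_le {α : Type*} [MeasurableSpace α] (μ : Measure α)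
    [IsFiniteMeasure μ] (s t : Set α) : μ.real (s ∪ t) + μ.real (s ∩ t) ≤ μ.real s + μ.real t := by
  have h₁ := measureReal_union_add_inter (μ := μ) (s := toMeasurable μ s)
    (measurableSet_toMeasurable μ t)
  have h₂ : μ.real (s ∪ t) ≤ μ.real (toMeasurable μ s ∪ toMeasurable μ t) :=
    measureReal_mono (union_subset_union (subset_toMeasurable μ s) (subset_toMeasurable μ t))
  have h₃ : μ.real (s ∩ t) ≤ μ.real (toMeasurable μ s ∩ toMeasurable μ t) :=
    measureReal_mono (inter_subset_inter (subset_toMeasurable μ s) (subset_toMeasurable μ t))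
  have h₄ (s : Set α) : μ.real (toMeasurable μ s) = μ.real s := by
    simp [measureReal_def, measure_toMeasurable]
  rw [h₄, h₄] at h₁
  linarith

/-- The intersections of a closed set with the preimage of a measurable set. -/
def closedInterPreimage {X Y : Type*} [TopologicalSpace X] [MeasurableSpace Y] (π : X → Y) :
    Set (Set X) :=
  {s | ∃ F B, IsClosed F ∧ MeasurableSet B ∧ s = F ∩ π ⁻¹' B}

lemma IsClosed.mem_closedInterPreimage {X Y : Type*} [TopologicalSpace X] [MeasurableSpace Y]
    (π : X → Y) {F : Set X} (hF : IsClosed F) : F ∈ closedInterPreimage π :=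
  ⟨F, Set.univ, hF, .univ, by simp⟩

lemma MeasurableSet.preimage_mem_closedInterPreimage {X Y : Type*} [TopologicalSpace X]
    [MeasurableSpace Y] (π : X → Y) {B : Set Y} (hB : MeasurableSet B) :
    π ⁻¹' B ∈ closedInterPreimage π :=
  ⟨Set.univ, B, isClosed_univ, hB, by simp⟩

lemma infClosed_closedInterPreimage {X Y : Type*} [TopologicalSpace X] [MeasurableSpace Y]
    (π : X → Y) : InfClosed (closedInterPreimage π) := by
  rintro _ ⟨F, B, hF, hB, rfl⟩ _ ⟨G, C, hG, hC, rfl⟩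
  exact ⟨F ∩ G, B ∩ C, hF.inter hG, hB.inter hC, inter_inter_inter_comm ..⟩

lemma isCompact_inter_fiber_of_mem_supClosure {X Y : Type*} [TopologicalSpace X] [CompactSpace X]
    [TopologicalSpace Y] [T2Space Y] [MeasurableSpace Y] {π : X → Y}
    (hc : Continuous π) {K : Set X} (hK : K ∈ supClosure (closedInterPreimage π)) (y : Y) :
    IsCompact (K ∩ π ⁻¹' {y}) := by
  refine supClosure_min (t := {K | IsCompact (K ∩ π ⁻¹' {y})}) ?_ ?_ hK
  · rintro _ ⟨F, B, hF, -, rfl⟩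
    by_cases hy : y ∈ B
    · have : F ∩ π ⁻¹' B ∩ π ⁻¹' {y} = F ∩ π ⁻¹' {y} := by
        ext x
        simp only [mem_inter_iff, mem_preimage, mem_singleton_iff]
        exact ⟨fun h ↦ ⟨h.1.1, h.2⟩, fun h ↦ ⟨⟨h.1, h.2 ▸ hy⟩, h.2⟩⟩
      change IsCompact _
      rw [this]
      exact (hF.inter (isClosed_singleton.preimage hc)).isCompact
    · have : F ∩ π ⁻¹' B ∩ π ⁻¹' {y} = ∅ := by
        ext x
        simp only [mem_inter_iff, mem_preimage, mem_singleton_iff, mem_empty_iff_false, iff_false]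
        exact fun h ↦ hy (h.2 ▸ h.1.2)
      change IsCompact _
      rw [this]
      exact isCompact_empty
  · intro K hK L hL
    change IsCompact ((K ∪ L) ∩ _)
    rw [union_inter_distrib_right]
    exact IsCompact.union hK hL

lemma measurableSet_image_of_mem_supClosure {X Y : Type*} [TopologicalSpace X] [CompactSpace X]
    [TopologicalSpace Y] [T2Space Y] [MeasurableSpace Y] [BorelSpace Y] {π : X → Y}
    (hc : Continuous π) {K : Set X} (hK : K ∈ supClosure (closedInterPreimage π)) :
    MeasurableSet (π '' K) := by
  refine supClosure_min (t := {K | MeasurableSet (π '' K)}) ?_ ?_ hK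
  · rintro _ ⟨F, B, hF, hB, rfl⟩
    change MeasurableSet _
    rw [image_inter_preimage]
    exact (hc.isClosedMap F hF).measurableSet.inter hB
  · intro K hK L hL
    change MeasurableSet (π '' (K ∪ L))
    rw [image_union]
    exact MeasurableSet.union hK hL

lemma iInter_image_eq_empty_of_mem_supClosure {X Y : Type*} [TopologicalSpace X] [CompactSpace X]
    [T2Space X]
    [TopologicalSpace Y] [T2Space Y] [MeasurableSpace Y] {π : X → Y}
    (hc : Continuous π) {L : ℕ → Set X}
    (hL : ∀ n, L n ∈ supClosure (closedInterPreimage π)) (hanti : Antitone L)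
    (hL₀ : ⋂ n, L n = ∅) : ⋂ n, π '' L n = ∅ := by
  refine eq_empty_of_forall_notMem fun y hy ↦ ?_
  have hcomp (n : ℕ) := isCompact_inter_fiber_of_mem_supClosure hc (hL n) y
  obtain ⟨x, hx⟩ := IsCompact.nonempty_iInter_of_sequence_nonempty_isCompact_isClosed
    (fun n ↦ L n ∩ π ⁻¹' {y}) (fun n ↦ inter_subset_inter_left _ (hanti n.le_succ))
    (fun n ↦ by
      obtain ⟨x, hx, hxy⟩ := mem_iInter.1 hy n
      exact ⟨x, hx, hxy⟩)
    (hcomp 0) (fun n ↦ (hcomp n).isClosed)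
  exact (hL₀ ▸ mem_iInter.2 fun n ↦ (mem_iInter.1 hx n).1 : x ∈ (∅ : Set X))

lemma isInnerSupermodular_one_sub_measureReal_image {X Y : Type*} [TopologicalSpace X]
    [MeasurableSpace Y] {π : X → Y}
    (hs : Function.Surjective π) (ν : Measure Y) [IsProbabilityMeasure ν] :
    IsInnerSupermodular (supClosure (closedInterPreimage π))
      (fun s ↦ 1 - ν.real (π '' sᶜ)) where
  mono s t hst := sub_le_sub_left (measureReal_mono (image_mono (compl_subset_compl.2 hst))) 1
  empty := by simp [hs.range_eq]
  univ := by simp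
  supermodular s t := by
    have h₁ := measureReal_union_add_inter_le ν (π '' sᶜ) (π '' tᶜ)
    have h₂ : ν.real (π '' (sᶜ ∩ tᶜ)) ≤ ν.real (π '' sᶜ ∩ π '' tᶜ) :=
      measureReal_mono (image_inter_subset ..)
    rw [← image_union] at h₁
    rw [compl_union, compl_inter]
    linarith
  inner s ε hε := by
    refine ⟨π ⁻¹' (toMeasurable ν (π '' sᶜ))ᶜ, subset_supClosure <|
      (measurableSet_toMeasurable _ _).compl.preimage_mem_closedInterPreimage π, ?_, ?_⟩
    · intro x hx
      by_contra hxs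
      exact hx (subset_toMeasurable _ _ (mem_image_of_mem π hxs))
    · rw [← preimage_compl, compl_compl, image_preimage_eq _ hs]
      simp [measureReal_def, measure_toMeasurable, hε]

/-- Every Borel probability measure, regular or not, lifts along a continuous surjection from a
compact Hausdorff space. -/
theorem exists_measure_map_eq {X Y : Type*} [TopologicalSpace X] [CompactSpace X] [T2Space X]
    [TopologicalSpace Y] [T2Space Y] [MeasurableSpace X] [BorelSpace X] [MeasurableSpace Y]
    [BorelSpace Y] {π : X → Y}
    (hc : Continuous π) (hs : Function.Surjective π) (ν : Measure Y)
    [IsProbabilityMeasure ν] : ∃ μ : Measure X, μ.map π = ν := by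
  have hinf := (infClosed_closedInterPreimage π).supClosure
  obtain ⟨φ, hφ, hle, hadd⟩ :=
    (isInnerSupermodular_one_sub_measureReal_image hs ν).exists_ge_forall_add_compl
      supClosed_supClosure hinf
  have hadd₀ {K : Set X} (hK : K ∈ closedInterPreimage π) := hadd K (subset_supClosure hK)
  have hge {B : Set Y} (hB : MeasurableSet B) : ν.real B ≤ φ (π ⁻¹' B) := by
    have h₁ := hle (π ⁻¹' B)
    simp only at h₁
    rw [← preimage_compl, image_preimage_eq _ hs, probReal_compl_eq_one_sub hB] at h₁
    linarith
  have hpre {B : Set Y} (hB : MeasurableSet B) : φ (π ⁻¹' B) = ν.real B := by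
    have h₁ := hge hB.compl
    rw [probReal_compl_eq_one_sub hB, preimage_compl] at h₁
    linarith [hge hB, hφ.add_compl_le (π ⁻¹' B)]
  obtain ⟨μ, hμ⟩ := hφ.exists_measure hinf (fun L hL hanti hL₀ ↦ by
    have hmeas (n : ℕ) := measurableSet_image_of_mem_supClosure hc (hL n)
    have h₁ : Tendsto (fun n ↦ ν.real (π '' L n)) atTop (𝓝 0) := by
      have := tendsto_measure_iInter_atTop (μ := ν) (fun n ↦ (hmeas n).nullMeasurableSet)
        (fun m n hmn ↦ image_mono (hanti hmn)) ⟨0, measure_ne_top _ _⟩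
      rw [iInter_image_eq_empty_of_mem_supClosure hc hL hanti hL₀, measure_empty] at this
      exact (ENNReal.tendsto_toReal ENNReal.zero_ne_top).comp this
    refine squeeze_zero (fun n ↦ hφ.nonneg _) (fun n ↦ ?_) h₁
    rw [← hpre (hmeas n)]
    exact hφ.mono (subset_preimage_image π _)) (m := ‹_›) (by
      rw [BorelSpace.measurable_eq (α := X), borel_eq_generateFrom_isClosed]
      exact MeasurableSpace.generateFrom_mono fun F hF ↦
        hadd₀ (IsClosed.mem_closedInterPreimage π hF))
  refine ⟨μ, Measure.ext fun B hB ↦ ?_⟩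
  rw [Measure.map_apply hc.measurable hB, hμ _ (hc.measurable hB)
    (hadd₀ (hB.preimage_mem_closedInterPreimage π)), hpre hB, ofReal_measureReal]

lemma IsIrreducibleMap.of_pushforwardMap {X Y : Type*} [TopologicalSpace X] [CompactSpace X]
    [T2Space X]
    [TopologicalSpace Y] [T2Space Y] [MeasurableSpace X] [BorelSpace X] [MeasurableSpace Y]
    [BorelSpace Y] {π : X → Y}
    (hc : Continuous π)
    (h : IsIrreducibleMap (pushforwardMap hc)) : IsIrreducibleMap π := by
  intro A hA hπA
  by_contra hne
  obtain ⟨x₀, hx₀⟩ := (ne_univ_iff_exists_notMem A).1 hne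
  obtain ⟨f, hfA, hf₀, -⟩ := exists_continuous_zero_one_of_isClosed hA
    (isClosed_singleton (x := x₀)) (disjoint_singleton_right.2 hx₀)
  let g := BoundedContinuousFunction.mkOfCompact f
  have hclosed : IsClosed {μ : ProbabilityMeasure X | ∫ x, g x ∂(μ : Measure X) = 0} :=
    isClosed_eq (ProbabilityMeasure.continuous_integral_boundedContinuousFunction g)
      continuous_const
  have huniv := h _ hclosed <| eq_univ_of_forall fun ν ↦ by
    have : CompactSpace A := isCompact_iff_compactSpace.1 hA.isCompact
    have hsurj : Function.Surjective (π ∘ ((↑) : A → X)) := fun y ↦ by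
      obtain ⟨x, hx, rfl⟩ := (hπA ▸ mem_univ y : y ∈ π '' A)
      exact ⟨⟨x, hx⟩, rfl⟩
    obtain ⟨μ, hμ⟩ := exists_measure_map_eq (hc.comp continuous_subtype_val) hsurj (ν : Measure Y)
    have hmap : (μ.map ((↑) : A → X)).map π = ν := by
      rw [Measure.map_map hc.measurable measurable_subtype_coe, hμ]
    have hprob : IsProbabilityMeasure (μ.map ((↑) : A → X)) :=
      ⟨by rw [← preimage_univ (f := π), ← Measure.map_apply hc.measurable .univ, hmap,
        measure_univ]⟩
    refine ⟨⟨_, hprob⟩, ?_, Subtype.ext hmap⟩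
    change ∫ x, g x ∂(μ.map ((↑) : A → X)) = 0
    rw [integral_map measurable_subtype_coe.aemeasurable
      g.continuous.measurable.aestronglyMeasurable]
    exact integral_eq_zero_of_ae (.of_forall fun x ↦ hfA x.2)
  have hdirac : (⟨Measure.dirac x₀, inferInstance⟩ : ProbabilityMeasure X) ∈
      {μ : ProbabilityMeasure X | ∫ x, g x ∂(μ : Measure X) = 0} := huniv ▸ mem_univ _
  change ∫ x, g x ∂(Measure.dirac x₀) = 0 at hdirac
  rw [integral_dirac' _ _ g.continuous.stronglyMeasurable] at hdirac
  have : g x₀ = 1 := hf₀ rfl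
  linarith

lemma IsIrreducibleMap.exists_preimage_singleton_subset {X Y : Type*} [TopologicalSpace X]
    {π : X → Y} (h : IsIrreducibleMap π) {U : Set X}
    (hU : IsOpen U) (hne : U.Nonempty) : ∃ y, π ⁻¹' {y} ⊆ U := by
  by_contra! hcon
  have := h Uᶜ hU.isClosed_compl <| eq_univ_of_forall fun y ↦ by
    obtain ⟨x, hx, hxU⟩ := not_subset.1 (hcon y)
    exact ⟨x, hxU, hx⟩
  exact hne.ne_empty (compl_univ_iff.1 this)

/-- The points of `X` can be moved measurably to fibers of an irreducible map on which finitely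
many given continuous functions are almost constant. -/
lemma IsIrreducibleMap.exists_measurable_fiber_near {X Y : Type*} [TopologicalSpace X]
    [MeasurableSpace X] [OpensMeasurableSpace X] [MeasurableSpace Y] {π : X → Y}
    (h : IsIrreducibleMap π) {ι : Type*} [Finite ι] (f : ι → X → ℝ) (hf : ∀ i, Continuous (f i))
    {ε : ℝ} (hε : 0 < ε) :
    ∃ s : X → Y, Measurable s ∧ ∀ x z, π z = s x → ∀ i, |f i z - f i x| ≤ ε := by
  cases isEmpty_or_nonempty X with
  | inl _ => exact ⟨fun x ↦ isEmptyElim x, measurable_of_empty _, fun x ↦ isEmptyElim x⟩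
  | inr hX =>
  have : Nonempty Y := hX.map π
  have hfiber (k : ι → ℤ) : ∃ y, ∀ x, (∀ i, |f i x * (2 / ε) - k i| < 1) →
      ∀ z, π z = y → ∀ i, |f i z * (2 / ε) - k i| < 1 := by
    by_cases hne : ∃ x, ∀ i, |f i x * (2 / ε) - k i| < 1
    · have hopen : IsOpen {x | ∀ i, |f i x * (2 / ε) - k i| < 1} := by
        rw [ofPred_forall]
        exact isOpen_iInter_of_finite fun i ↦ isOpen_lt (by fun_prop) continuous_const
      obtain ⟨y, hy⟩ := h.exists_preimage_singleton_subset hopen hne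
      exact ⟨y, fun _ _ z hz ↦ hy hz⟩
    · exact ⟨Classical.arbitrary Y, fun x hx ↦ (hne ⟨x, hx⟩).elim⟩
  choose y hy using hfiber
  refine ⟨fun x ↦ y fun i ↦ ⌊f i x * (2 / ε)⌋, (measurable_of_countable y).comp <|
    measurable_pi_lambda _ fun i ↦ Int.measurable_floor.comp ((hf i).measurable.mul_const _),
    fun x z hz i ↦ ?_⟩
  have hx (i : ι) : |f i x * (2 / ε) - ⌊f i x * (2 / ε)⌋| < 1 := by
    rw [Int.self_sub_floor, Int.abs_fract]
    exact Int.fract_lt_one _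
  have h₁ := abs_lt.1 (hx i)
  have h₂ := abs_lt.1 (hy _ x hx z hz i)
  have h₃ : |(f i z - f i x) * (2 / ε)| ≤ 2 := abs_le.2 ⟨by linarith, by linarith⟩
  rw [abs_mul, abs_of_pos (div_pos two_pos hε), mul_div_assoc', div_le_iff₀ hε] at h₃
  linarith

lemma integral_le_of_forall_fiber_le {X Y : Type*} [TopologicalSpace X] [CompactSpace X]
    [TopologicalSpace Y] [T2Space Y] [MeasurableSpace X] [BorelSpace X] [MeasurableSpace Y]
    [BorelSpace Y] {π : X → Y}
    (hc : Continuous π) (hs : Function.Surjective π)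
    {μ μ' : Measure X} [IsProbabilityMeasure μ] [IsProbabilityMeasure μ'] {s : X → Y}
    (hsm : Measurable s) (hμ' : μ'.map π = μ.map s) {f : X → ℝ} (hf : Continuous f) {ε : ℝ}
    (hfs : ∀ x z, π z = s x → f z ≤ f x + ε) :
    ∫ x, f x ∂μ' ≤ ∫ x, f x ∂μ + ε := by
  have hmax (y : Y) : ∃ x, π x = y ∧ ∀ z, π z = y → f z ≤ f x := by
    obtain ⟨x, hx, hmax⟩ := (isClosed_singleton.preimage hc).isCompact.exists_isMaxOn
      ((singleton_nonempty y).preimage hs) hf.continuousOn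
    exact ⟨x, hx, fun z hz ↦ hmax hz⟩
  choose m hπm hm using hmax
  have hmeas : Measurable (f ∘ m) := measurable_of_Ici fun c ↦ by
    have : f ∘ m ⁻¹' Ici c = π '' (f ⁻¹' Ici c) := by
      ext y
      refine ⟨fun hy ↦ ⟨m y, hy, hπm y⟩, ?_⟩
      rintro ⟨x, hx, rfl⟩
      exact le_trans hx (hm _ x rfl)
    rw [this]
    exact (hc.isClosedMap _ (isClosed_Ici.preimage hf)).measurableSet
  obtain ⟨C, hC⟩ := (isCompact_range hf).isBounded.exists_norm_le
  have hint {Z : Type _} [MeasurableSpace Z] {ρ : Measure Z} [IsProbabilityMeasure ρ] {g : Z → X}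
      (hg : Measurable (f ∘ g)) : Integrable (fun z ↦ f (g z)) ρ :=
    .of_bound hg.aestronglyMeasurable C (.of_forall fun z ↦ hC _ (mem_range_self _))
  calc ∫ x, f x ∂μ' ≤ ∫ x, f (m (π x)) ∂μ' :=
        integral_mono (hint (g := id) hf.measurable) (hint (hmeas.comp hc.measurable))
          fun x ↦ hm _ x rfl
    _ = ∫ y, f (m y) ∂(μ'.map π) :=
        (integral_map hc.measurable.aemeasurable hmeas.aestronglyMeasurable).symm
    _ = ∫ x, f (m (s x)) ∂μ := by
        rw [hμ']
        exact integral_map hsm.aemeasurable hmeas.aestronglyMeasurable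
    _ ≤ ∫ x, (f x + ε) ∂μ :=
        integral_mono (hint (hmeas.comp hsm))
          ((hint (g := id) hf.measurable).add (integrable_const ε)) fun x ↦ hfs x _ (hπm _)
    _ = ∫ x, f x ∂μ + ε := by
        rw [integral_add (f := f) (hint (g := id) hf.measurable) (integrable_const ε)]
        simp

lemma IsIrreducibleMap.pushforwardMap {X Y : Type*} [TopologicalSpace X] [CompactSpace X]
    [T2Space X]
    [TopologicalSpace Y] [T2Space Y] [MeasurableSpace X] [BorelSpace X] [MeasurableSpace Y]
    [BorelSpace Y] {π : X → Y}
    (hc : Continuous π) (hs : Function.Surjective π)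
    (h : IsIrreducibleMap π) : IsIrreducibleMap (pushforwardMap hc) := by
  classical
  intro 𝒜 h𝒜 himage
  refine eq_univ_of_forall fun μ ↦ ?_
  have hnear (p : Finset (BoundedContinuousFunction X ℝ) × ℕ) : ∃ μ' ∈ 𝒜, ∀ f ∈ p.1,
      |∫ x, f x ∂(μ' : Measure X) - ∫ x, f x ∂(μ : Measure X)| ≤ 1 / ((p.2 : ℝ) + 1) := by
    obtain ⟨s, hsm, hfs⟩ := h.exists_measurable_fiber_near (fun f : p.1 ↦ f.1)
      (fun f ↦ f.1.continuous) (Nat.one_div_pos_of_nat (α := ℝ) (n := p.2))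
    obtain ⟨μ', hμ', hmap⟩ := (himage ▸ mem_univ _ : μ.map hsm.aemeasurable ∈ _ '' 𝒜)
    have hmap' : (μ' : Measure X).map π = (μ : Measure X).map s := congrArg Subtype.val hmap
    refine ⟨μ', hμ', fun f hf ↦ abs_sub_le_iff.2 ⟨?_, ?_⟩⟩
    · have := integral_le_of_forall_fiber_le hc hs hsm hmap' f.continuous
        fun x z hz ↦ sub_le_iff_le_add'.1 (abs_sub_le_iff.1 (hfs x z hz ⟨f, hf⟩)).1
      linarith
    · have := integral_le_of_forall_fiber_le hc hs hsm hmap' (f := fun x ↦ -f x)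
        f.continuous.neg fun x z hz ↦ neg_le_iff_add_nonneg'.2 <| by
          linarith [(abs_sub_le_iff.1 (hfs x z hz ⟨f, hf⟩)).2]
      simp only [integral_neg] at this
      linarith
  choose μ' hμ' hdist using hnear
  refine h𝒜.mem_of_tendsto (b := atTop) (f := μ') ?_ (.of_forall hμ')
  refine ProbabilityMeasure.tendsto_iff_forall_integral_tendsto.2 fun f ↦ ?_
  rw [tendsto_iff_dist_tendsto_zero]
  refine squeeze_zero' (.of_forall fun _ ↦ dist_nonneg) ?_
    (tendsto_one_div_add_atTop_nhds_zero_nat.comp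
      (tendsto_snd.mono_left prod_atTop_atTop_eq.symm.le :
        Tendsto Prod.snd (atTop : Filter (Finset (BoundedContinuousFunction X ℝ) × ℕ)) atTop))
  filter_upwards [eventually_ge_atTop ({f}, 0)] with p hp
  exact hdist p f (hp.1 (Finset.mem_singleton_self f))

theorem stmt_0 {X Y : Type*} [TopologicalSpace X] [CompactSpace X] [T2Space X]
    [TopologicalSpace Y] [CompactSpace Y] [T2Space Y] [MeasurableSpace X] [BorelSpace X] [MeasurableSpace Y] [BorelSpace Y]
    (π : X → Y) (hc : Continuous π) (hs : Function.Surjective π) :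
    IsIrreducibleMap (pushforwardMap hc) ↔ IsIrreducibleMap π := by
  exact ⟨.of_pushforwardMap hc, .pushforwardMap hc hs⟩
end

section
/- Let π : X → Y be a continuous surjection between compact Hausdorff spaces. If π is almost one-to-one, then the push-forward map M(π) : M(X) → M(Y) is almost one-to-one. -/
open MeasureTheory Set

open scoped Topology BoundedContinuousFunction

/-- A probability measure is finitely supported in `D` if it is concentrated on a finite subset
of `D`. -/
def IsFinitelySupportedIn {X : Type*} [MeasurableSpace X] (D : Set X)
    (ν : ProbabilityMeasure X) : Prop :=
  ∃ t : Set X, t.Finite ∧ t ⊆ D ∧ (ν : Measure X) tᶜ = 0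

/-- The weak topology on probability measures is induced by integration against bounded
continuous real-valued functions. -/
lemma isInducing_integral_boundedContinuousFunction (X : Type*) [TopologicalSpace X]
    [MeasurableSpace X] [OpensMeasurableSpace X] :
    Topology.IsInducing
      (fun (μ : ProbabilityMeasure X) (f : X →ᵇ ℝ) ↦ ∫ x, f x ∂(μ : Measure X)) := by
  rw [Topology.isInducing_iff_nhds]
  intro μ
  refine le_antisymm ?_ ?_
  · exact (continuous_pi fun f ↦
      ProbabilityMeasure.continuous_integral_boundedContinuousFunction f).continuousAt.le_comap
  · rw [← Filter.tendsto_id']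
    refine (ProbabilityMeasure.tendsto_iff_forall_integral_tendsto (γ := ProbabilityMeasure X)
      (μs := id)).2 fun f ↦ ?_
    exact tendsto_pi_nhds.1 (Filter.tendsto_comap
      (f := fun (μ : ProbabilityMeasure X) (f : X →ᵇ ℝ) ↦ ∫ x, f x ∂(μ : Measure X))) f

/-- Vectors of integrals of finitely supported measures form a convex set. -/
lemma convex_integral_isFinitelySupportedIn {X ι : Type*} [TopologicalSpace X]
    [MeasurableSpace X] [OpensMeasurableSpace X] (D : Set X) (g : ι → X →ᵇ ℝ) :
    Convex ℝ ((fun (ν : ProbabilityMeasure X) (i : ι) ↦ ∫ x, g i x ∂(ν : Measure X)) ''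
      {ν | IsFinitelySupportedIn D ν}) := by
  rintro _ ⟨ν₁, ⟨t₁, ht₁, hD₁, h₁⟩, rfl⟩ _ ⟨ν₂, ⟨t₂, ht₂, hD₂, h₂⟩, rfl⟩ a b ha hb hab
  have hprob : IsProbabilityMeasure
      (ENNReal.ofReal a • (ν₁ : Measure X) + ENNReal.ofReal b • (ν₂ : Measure X)) := by
    constructor
    simp [← ENNReal.ofReal_add ha hb, hab]
  refine ⟨⟨_, hprob⟩, ⟨t₁ ∪ t₂, ht₁.union ht₂, union_subset hD₁ hD₂, ?_⟩, ?_⟩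
  · have h₁' := measure_mono_null (compl_subset_compl.2 (subset_union_left (t := t₂))) h₁
    have h₂' := measure_mono_null (compl_subset_compl.2 (subset_union_right (s := t₁))) h₂
    simp [h₁', h₂', -compl_union]
  · ext i
    have hint (ν : ProbabilityMeasure X) : Integrable (g i) (ν : Measure X) := (g i).integrable _
    simp only [ProbabilityMeasure.coe_mk, Pi.add_apply, Pi.smul_apply]
    rw [integral_add_measure ((hint ν₁).smul_measure ENNReal.ofReal_ne_top)
      ((hint ν₂).smul_measure ENNReal.ofReal_ne_top), integral_smul_measure,
      integral_smul_measure, ENNReal.toReal_ofReal ha, ENNReal.toReal_ofReal hb]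

/-- Probability measures finitely supported in a dense set are weakly dense. -/
lemma dense_isFinitelySupportedIn {X : Type*} [TopologicalSpace X] [T1Space X]
    [MeasurableSpace X] [OpensMeasurableSpace X] {D : Set X} (hD : Dense D) :
    Dense {ν : ProbabilityMeasure X | IsFinitelySupportedIn D ν} := by
  intro μ
  rw [(isInducing_integral_boundedContinuousFunction X).closure_eq_preimage_closure_image,
    mem_preimage, mem_closure_iff]
  intro U hU hμU
  obtain ⟨I, u, hu, hIU⟩ := isOpen_pi_iff.1 hU _ hμU
  let G : X → I → ℝ := fun x f ↦ (f : X →ᵇ ℝ) x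
  have hG : Continuous G := continuous_pi fun f ↦ (f : X →ᵇ ℝ).continuous
  set K := (fun (ν : ProbabilityMeasure X) (f : I) ↦ ∫ x, (f : X →ᵇ ℝ) x ∂(ν : Measure X)) ''
    {ν | IsFinitelySupportedIn D ν} with hK
  have hKconv : Convex ℝ K := convex_integral_isFinitelySupportedIn D _
  have hDK : ∀ x ∈ D, G x ∈ K := by
    intro x hx
    refine ⟨⟨Measure.dirac x, inferInstance⟩,
      ⟨{x}, finite_singleton x, singleton_subset_iff.2 hx, ?_⟩, ?_⟩
    · simp
    · ext f
      simp [G]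
  have hXK : ∀ x, G x ∈ closure K := fun x ↦
    map_mem_closure hG (hD x) hDK
  have hint : ∀ f : I, Integrable (G · f) (μ : Measure X) := fun f ↦
    (f : X →ᵇ ℝ).integrable _
  have hmem : ∫ x, G x ∂(μ : Measure X) ∈ closure K :=
    hKconv.closure.integral_mem isClosed_closure (Filter.Eventually.of_forall hXK)
      (Integrable.of_eval hint)
  obtain ⟨_, hv, ν, hν, rfl⟩ := mem_closure_iff.1 hmem (univ.pi fun f : I ↦ u f)
    (isOpen_set_pi finite_univ fun f _ ↦ (hu f f.2).1) (fun f _ ↦ by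
      rw [eval_integral hint]
      exact (hu f f.2).2)
  exact ⟨_, hIU fun f hf ↦ hv ⟨f, hf⟩ (mem_univ _), ν, hν, rfl⟩

/-- Probability measures finitely supported on injectivity points of `π` are injectivity points of
the push-forward map. -/
lemma IsFinitelySupportedIn.isInjectivityPoint_pushforwardMap {X Y : Type*} [TopologicalSpace X]
    [TopologicalSpace Y] [T1Space Y] [MeasurableSpace X] [BorelSpace X]
    [MeasurableSpace Y] [BorelSpace Y] {π : X → Y} (hc : Continuous π)
    {ν : ProbabilityMeasure X} (hν : IsFinitelySupportedIn {x | IsInjectivityPoint π x} ν) :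
    IsInjectivityPoint (pushforwardMap hc) ν := by
  obtain ⟨t, ht, htD, htν⟩ := hν
  have hpre : ∀ s ⊆ t, π ⁻¹' (π '' s) = s := by
    refine fun s hs ↦ (subset_preimage_image π s).antisymm' ?_
    rintro x ⟨y, hy, hyx⟩
    have hxy : x ∈ π ⁻¹' {π y} := hyx.symm
    rw [show π ⁻¹' {π y} = {y} from htD (hs hy)] at hxy
    exact hxy ▸ hy
  refine Subset.antisymm (fun ν' hν' ↦ ?_) (fun _ h ↦ h ▸ rfl)
  have hmap : (ν' : Measure X).map π = (ν : Measure X).map π :=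
    congrArg ProbabilityMeasure.toMeasure hν'
  have himage : ∀ s ⊆ t, MeasurableSet (π '' s) := fun s hs ↦
    ((ht.subset hs).image π).measurableSet
  have heq : ∀ s ⊆ t, (ν' : Measure X) s = (ν : Measure X) s := by
    intro s hs
    have := congrArg (fun m : Measure Y ↦ m (π '' s)) hmap
    simpa only [Measure.map_apply hc.measurable (himage s hs), hpre s hs] using this
  have htm : MeasurableSet t := hpre t Subset.rfl ▸ hc.measurable (himage t Subset.rfl)
  have htν' : (ν' : Measure X) tᶜ = 0 := by
    rw [prob_compl_eq_zero_iff htm, heq t Subset.rfl, ← prob_compl_eq_zero_iff htm, htν]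
  refine ProbabilityMeasure.eq_of_forall_toMeasure_apply_eq _ _ fun s _ ↦ ?_
  have h1 := measure_inter_add_sdiff (μ := (ν' : Measure X)) s htm
  have h2 := measure_inter_add_sdiff (μ := (ν : Measure X)) s htm
  rw [measure_mono_null (fun _ hx ↦ hx.2 : s \ t ⊆ tᶜ) htν', add_zero] at h1
  rw [measure_mono_null (fun _ hx ↦ hx.2 : s \ t ⊆ tᶜ) htν, add_zero] at h2
  rw [← h1, ← h2, heq _ inter_subset_right]

theorem stmt_1 {X Y : Type*} [TopologicalSpace X] [CompactSpace X] [T2Space X]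
    [TopologicalSpace Y] [CompactSpace Y] [T2Space Y] [MeasurableSpace X] [BorelSpace X] [MeasurableSpace Y] [BorelSpace Y]
    (π : X → Y) (hc : Continuous π) (hs : Function.Surjective π)
    (h : IsAlmostOneToOne π) :
    IsAlmostOneToOne (pushforwardMap hc) := by
  exact (dense_isFinitelySupportedIn h).mono fun _ hν ↦ hν.isInjectivityPoint_pushforwardMap hc
end

section
/- Let π : X → Y be a continuous surjection between compact Hausdorff spaces. If π is almost one-to-one, then the induced map H(π) : H(X) → H(Y), A ↦ π(A), between the hyperspaces is almost one-to-one. -/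
open MeasureTheory Set

/-- The hyperspace of all nonempty closed subsets of `X`. -/
def Hyperspace (X : Type*) [TopologicalSpace X] : Type _ :=
  {A : Set X // IsClosed A ∧ A.Nonempty}

/-- The Vietoris topology on the hyperspace, generated by the subbasic sets
`{A | A ⊆ U}` and `{A | A ∩ U ≠ ∅}` for `U` open. -/
instance Hyperspace.instTopologicalSpace (X : Type*) [TopologicalSpace X] :
    TopologicalSpace (Hyperspace X) :=
  TopologicalSpace.generateFrom
    ({S | ∃ U : Set X, IsOpen U ∧ S = {A : Hyperspace X | A.1 ⊆ U}} ∪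
      {S | ∃ U : Set X, IsOpen U ∧ S = {A : Hyperspace X | (A.1 ∩ U).Nonempty}})

/-- The induced map `H(π) : H(X) → H(Y)`, sending `A` to `π(A)`. -/
def hyperMap {X Y : Type*} [TopologicalSpace X] [TopologicalSpace Y]
    [CompactSpace X] [T2Space Y] {π : X → Y} (hc : Continuous π) :
    Hyperspace X → Hyperspace Y :=
  fun A => ⟨π '' A.1, (A.2.1.isCompact.image hc).isClosed, A.2.2.image π⟩

/-- A neighbourhood in the Vietoris subbasis contains a basic one of the form
`{B | B ⊆ U, B ∩ V ≠ ∅}`. -/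
lemma Hyperspace.exists_of_mem_subbasis {X : Type*} [TopologicalSpace X] {S : Set (Hyperspace X)}
    (hS : S ∈ {S | ∃ U : Set X, IsOpen U ∧ S = {A : Hyperspace X | A.1 ⊆ U}} ∪
      {S | ∃ U : Set X, IsOpen U ∧ S = {A : Hyperspace X | (A.1 ∩ U).Nonempty}})
    {A : Hyperspace X} (hA : A ∈ S) :
    ∃ U V : Set X, IsOpen U ∧ IsOpen V ∧ A.1 ⊆ U ∧ (A.1 ∩ V).Nonempty ∧
      ∀ B : Hyperspace X, B.1 ⊆ U → (B.1 ∩ V).Nonempty → B ∈ S := by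
  rcases hS with ⟨U, hU, rfl⟩ | ⟨V, hV, rfl⟩
  · exact ⟨U, univ, hU, isOpen_univ, hA, by simpa using A.2.2, fun B hB _ => hB⟩
  · exact ⟨univ, V, isOpen_univ, hV, subset_univ _, hA, fun B _ hB => hB⟩

/-- The finite nonempty subsets of a dense set are dense in the hyperspace. -/
lemma Hyperspace.dense_finite_subset {X : Type*} [TopologicalSpace X] [T1Space X] {D : Set X}
    (hD : Dense D) : Dense {A : Hyperspace X | A.1.Finite ∧ A.1 ⊆ D} := by
  rw [(TopologicalSpace.isTopologicalBasis_of_subbasis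
    (rfl : Hyperspace.instTopologicalSpace X = _)).dense_iff]
  rintro _ ⟨f, ⟨hf, hsub⟩, rfl⟩ ⟨A, hA⟩
  choose! U V hU hV hAU hAV hUV using
    fun S (hS : S ∈ f) => exists_of_mem_subbasis (hsub hS) (hA S hS)
  set W := ⋂ S ∈ f, U S
  have hW : IsOpen W := hf.isOpen_biInter hU
  have hAW : A.1 ⊆ W := subset_iInter₂ hAU
  obtain ⟨a, haW, haD⟩ := hD.inter_open_nonempty W hW (A.2.2.mono hAW)
  have : Nonempty X := ⟨a⟩
  choose! d hd hdD using fun S (hS : S ∈ f) =>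
    hD.inter_open_nonempty (W ∩ V S) (hW.inter (hV S hS))
      ((hAV S hS).mono (inter_subset_inter_left _ hAW))
  have hF : (insert a (d '' f)).Finite := (hf.image d).insert a
  refine ⟨⟨insert a (d '' f), hF.isClosed, insert_nonempty _ _⟩, fun S hS => ?_, hF,
    insert_subset haD (image_subset_iff.2 hdD)⟩
  refine hUV S hS _ ?_ ⟨d S, mem_insert_of_mem _ (mem_image_of_mem d hS), (hd S hS).2⟩
  exact (insert_subset haW (image_subset_iff.2 fun T hT => (hd T hT).1)).trans
    (biInter_subset_of_mem hS)

/-- A closed set consisting of injectivity points of `π` is an injectivity point of `H(π)`. -/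
lemma isInjectivityPoint_hyperMap {X Y : Type*} [TopologicalSpace X] [TopologicalSpace Y]
    [CompactSpace X] [T2Space Y] {π : X → Y} (hc : Continuous π) {A : Hyperspace X}
    (hA : A.1 ⊆ {x | IsInjectivityPoint π x}) : IsInjectivityPoint (hyperMap hc) A := by
  have key : ∀ x ∈ A.1, ∀ y, π y = π x → y = x := fun x hx y hy =>
    (hA hx).subset (show y ∈ π ⁻¹' {π x} from hy)
  refine Subset.antisymm (fun B hB => ?_) (singleton_subset_iff.2 rfl)
  have hBA : π '' B.1 = π '' A.1 := congrArg Subtype.val hB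
  refine Subtype.ext (Subset.antisymm (fun b hb => ?_) fun a ha => ?_)
  · obtain ⟨a, ha, hab⟩ := hBA.subset (mem_image_of_mem π hb)
    exact key a ha b hab.symm ▸ ha
  · obtain ⟨b, hb, hba⟩ := hBA.superset (mem_image_of_mem π ha)
    exact key a ha b hba ▸ hb

theorem stmt_2 {X Y : Type*} [TopologicalSpace X] [CompactSpace X] [T2Space X]
    [TopologicalSpace Y] [CompactSpace Y] [T2Space Y]
    (π : X → Y) (hc : Continuous π) (hs : Function.Surjective π)
    (h : IsAlmostOneToOne π) :
    IsAlmostOneToOne (hyperMap hc) := by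
  exact (Hyperspace.dense_finite_subset h).mono fun _ hA => isInjectivityPoint_hyperMap hc hA.2
end

section
/- Let π : X → Y be a continuous surjection between compact Hausdorff spaces. If the push-forward map M(π) : M(X) → M(Y) is semi-open, then π is semi-open. -/
open MeasureTheory Set

open Filter Topology Uniformity

theorem MeasureTheory.SimpleFunc.exists_selection {Y : Type*} [MeasurableSpace Y] [Nonempty Y]
    (A : Y → Set Y) (hA : ∀ d, MeasurableSet (A d)) (t : Finset Y) :
    ∃ T : SimpleFunc Y Y, ∀ y ∈ ⋃ d ∈ t, A d, T y ∈ t ∧ y ∈ A (T y) := by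
  classical
  induction t using Finset.induction_on with
  | empty => exact ⟨SimpleFunc.const Y (Classical.arbitrary Y), by simp⟩
  | insert a t _ ih =>
    obtain ⟨T, hT⟩ := ih
    refine ⟨SimpleFunc.piecewise (A a) (hA a) (SimpleFunc.const Y a) T, fun y hy => ?_⟩
    by_cases hya : y ∈ A a
    · simp [hya]
    · have hy' : y ∈ ⋃ d ∈ t, A d := by simpa [hya] using hy
      simpa [hya] using ⟨Or.inr (hT y hy').1, (hT y hy').2⟩

theorem Dense.exists_simpleFunc_forall_mem_uniformity {Y : Type*} [UniformSpace Y] [CompactSpace Y]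
    [MeasurableSpace Y] [OpensMeasurableSpace Y] [Nonempty Y] {D : Set Y} (hD : Dense D)
    {E : Set (Y × Y)} (hE : E ∈ 𝓤 Y) :
    ∃ T : SimpleFunc Y Y, ∀ y, T y ∈ D ∧ (y, T y) ∈ E := by
  let A : Y → Set Y := fun d => {y | (y, d) ∈ interior E}
  have hA : ∀ d, IsOpen (A d) := fun d =>
    isOpen_interior.preimage (Continuous.prodMk_left d)
  have hcover : (univ : Set Y) ⊆ ⋃ d : D, A d := by
    intro y _
    have hmem : (y, y) ∈ interior E :=
      mem_uniformity_of_eq (interior_mem_uniformity hE) rfl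
    obtain ⟨d, hd, hdD⟩ := hD.inter_open_nonempty {z | (y, z) ∈ interior E}
      (isOpen_interior.preimage (Continuous.prodMk_right y)) ⟨y, hmem⟩
    exact mem_iUnion.2 ⟨⟨d, hdD⟩, hd⟩
  obtain ⟨t, ht⟩ := isCompact_univ.elim_finite_subcover (fun d : D => A d) (fun d => hA d) hcover
  obtain ⟨T, hT⟩ := SimpleFunc.exists_selection A (fun d => (hA d).measurableSet)
    (t.map (Function.Embedding.subtype _))
  refine ⟨T, fun y => ?_⟩
  have hy : y ∈ ⋃ d ∈ t.map (Function.Embedding.subtype _), A d := by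
    obtain ⟨d, hdt, hd⟩ := mem_iUnion₂.1 (ht (mem_univ y))
    exact mem_iUnion₂.2 ⟨d, Finset.mem_map_of_mem (Function.Embedding.subtype _) hdt, hd⟩
  obtain ⟨hTt, hTA⟩ := hT y hy
  obtain ⟨d, -, hd⟩ := Finset.mem_map.1 hTt
  exact ⟨hd ▸ d.2, interior_subset hTA⟩

/-- Probability measures that do not charge the complement of a given dense set are dense. -/
theorem Dense.dense_setOf_probabilityMeasure_compl_eq_zero {Y : Type*} [TopologicalSpace Y]
    [CompactSpace Y] [T2Space Y] [MeasurableSpace Y] [BorelSpace Y] {D : Set Y} (hD : Dense D)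
    (hDm : MeasurableSet D) :
    Dense {ν : ProbabilityMeasure Y | (ν : Measure Y) Dᶜ = 0} := by
  intro ν
  let _ : UniformSpace Y := uniformSpaceOfCompactR1
  have : Nonempty Y := ν.nonempty
  let S := {T : SimpleFunc Y Y // ∀ y, T y ∈ D}
  let L : Filter S := comap (fun T => range fun y => (y, T.1 y)) (𝓤 Y).smallSets
  have : L.NeBot := by
    refine comap_neBot fun W hW => ?_
    obtain ⟨E, hE, hEW⟩ := eventually_smallSets.1 hW
    obtain ⟨T, hT⟩ := hD.exists_simpleFunc_forall_mem_uniformity hE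
    exact ⟨⟨T, fun y => (hT y).1⟩, hEW _ (range_subset_iff.2 fun y => (hT y).2)⟩
  have hL : ∀ E ∈ 𝓤 Y, ∀ᶠ T : S in L, ∀ y, (y, T.1 y) ∈ E := fun E hE =>
    ((eventually_smallSets_subset.2 hE).comap _).mono fun T hT => range_subset_iff.1 hT
  refine mem_closure_of_tendsto (b := L)
    (f := fun T => ν.map T.1.measurable.aemeasurable) ?_ (Eventually.of_forall fun T => ?_)
  · refine ProbabilityMeasure.tendsto_iff_forall_integral_tendsto.2 fun f => ?_
    refine Metric.tendsto_nhds.2 fun ε hε => ?_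
    have hf : UniformContinuous f := CompactSpace.uniformContinuous_of_continuous f.continuous
    filter_upwards [hL _ (hf (Metric.dist_mem_uniformity (half_pos hε)))] with T hT
    have hint : Integrable (fun y => f (T.1 y)) (ν : Measure Y) :=
      (f.integrable ((ν : Measure Y).map T.1)).comp_measurable T.1.measurable
    rw [ProbabilityMeasure.toMeasure_map,
      integral_map T.1.measurable.aemeasurable f.continuous.aestronglyMeasurable,
      dist_eq_norm, ← integral_sub hint (f.integrable _)]
    refine (norm_integral_le_of_norm_le_const (C := ε / 2)
      (Eventually.of_forall fun y => ?_)).trans_lt ?_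
    · rw [← dist_eq_norm, dist_comm]
      exact (hT y).le
    · simpa using hε
  · have hempty : T.1 ⁻¹' Dᶜ = ∅ := eq_empty_of_forall_notMem fun y hy => hy (T.2 y)
    simp [Measure.map_apply T.1.measurable hDm.compl, hempty]

theorem stmt_5 {X Y : Type*} [TopologicalSpace X] [CompactSpace X] [T2Space X]
    [TopologicalSpace Y] [CompactSpace Y] [T2Space Y] [MeasurableSpace X] [BorelSpace X] [MeasurableSpace Y] [BorelSpace Y]
    (π : X → Y) (hc : Continuous π) (hs : Function.Surjective π)
    (h : IsSemiOpenMap (pushforwardMap hc)) :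
    IsSemiOpenMap π := by
  intro U hU hUne
  by_contra hint
  obtain ⟨x, hx⟩ := hUne
  obtain ⟨K, hK, hKc, hKU⟩ := exists_mem_nhds_isClosed_subset (hU.mem_nhds hx)
  obtain ⟨f, hf0, hf1, -⟩ := exists_continuous_zero_one_of_isClosed
    (isOpen_interior (s := K)).isClosed_compl (isClosed_singleton (x := x))
    (disjoint_singleton_right.2 fun hxK => hxK (mem_interior_iff_mem_nhds.2 hK))
  have hF : IsClosed (π '' K) := hc.isClosedMap _ hKc
  have hD : Dense (π '' K)ᶜ := by
    rw [← interior_eq_empty_iff_dense_compl, ← not_nonempty_iff_eq_empty]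
    exact fun hne => hint (hne.mono (interior_mono (image_mono hKU)))
  have hW : IsOpen {μ : ProbabilityMeasure X | 0 < ∫ z, f z ∂(μ : Measure X)} :=
    isOpen_lt continuous_const (ProbabilityMeasure.continuous_integral_continuousMap f)
  have hWne : {μ : ProbabilityMeasure X | 0 < ∫ z, f z ∂(μ : Measure X)}.Nonempty :=
    ⟨⟨Measure.dirac x, inferInstance⟩, by
      change 0 < ∫ z, f z ∂(Measure.dirac x)
      rw [integral_dirac, hf1 rfl]
      exact one_pos⟩
  obtain ⟨ν, hνV, hν⟩ :=
    (hD.dense_setOf_probabilityMeasure_compl_eq_zero hF.measurableSet.compl).inter_open_nonempty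
      _ isOpen_interior (h _ hW hWne)
  obtain ⟨μ, hμ, rfl⟩ := interior_subset hνV
  have hnull : (μ : Measure X) (π ⁻¹' (π '' K)) = 0 := by
    simpa [pushforwardMap, Measure.map_apply hc.measurable hF.measurableSet] using hν
  have hfz : ∀ᵐ z ∂(μ : Measure X), f z = 0 := by
    filter_upwards [measure_eq_zero_iff_ae_notMem.1 hnull] with z hz
    exact hf0 fun hzK => hz (mem_image_of_mem π (interior_subset hzK))
  exact hμ.ne' (integral_eq_zero_of_ae hfz)
end

section
/- Let π : X → Y be a continuous surjection between compact Hausdorff spaces. If the induced map H(π) : H(X) → H(Y), A ↦ π(A), between the hyperspaces is semi-open, then π is semi-open. -/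
open MeasureTheory Set

/-- Adjoining a point to a fixed nonempty closed set. -/
def Hyperspace.insertPoint {Y : Type*} [TopologicalSpace Y] [T1Space Y]
    (B : Hyperspace Y) (y : Y) : Hyperspace Y :=
  ⟨insert y B.1, by
    rw [Set.insert_eq]
    exact isClosed_singleton.union B.2.1, Set.insert_nonempty y B.1⟩

theorem Hyperspace.continuous_insertPoint {Y : Type*} [TopologicalSpace Y] [T1Space Y]
    (B : Hyperspace Y) : Continuous B.insertPoint := by
  refine continuous_generateFrom_iff.2 ?_
  rintro _ (⟨V, hV, rfl⟩ | ⟨V, hV, rfl⟩)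
  · have : B.insertPoint ⁻¹' {A | A.1 ⊆ V} = V ∩ {_y | B.1 ⊆ V} := by
      ext y
      exact Set.insert_subset_iff
    rw [this]
    exact hV.inter isOpen_const
  · have : B.insertPoint ⁻¹' {A | (A.1 ∩ V).Nonempty} = V ∪ {_y | (B.1 ∩ V).Nonempty} := by
      ext y
      change (insert y B.1 ∩ V).Nonempty ↔ y ∈ V ∨ (B.1 ∩ V).Nonempty
      simp only [Set.Nonempty, Set.mem_inter_iff, Set.mem_insert_iff, or_and_right, exists_or,
        exists_eq_left]
    rw [this]
    exact hV.union isOpen_const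

theorem Hyperspace.isOpen_setOf_subset {X : Type*} [TopologicalSpace X] {U : Set X}
    (hU : IsOpen U) : IsOpen {A : Hyperspace X | A.1 ⊆ U} :=
  TopologicalSpace.isOpen_generateFrom_of_mem (Or.inl ⟨U, hU, rfl⟩)

theorem stmt_6 {X Y : Type*} [TopologicalSpace X] [CompactSpace X] [T2Space X]
    [TopologicalSpace Y] [CompactSpace Y] [T2Space Y]
    (π : X → Y) (hc : Continuous π) (hs : Function.Surjective π)
    (h : IsSemiOpenMap (hyperMap hc)) :
    IsSemiOpenMap π := by
  rintro U hU ⟨x, hx⟩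
  obtain ⟨B, hB⟩ := h {A | A.1 ⊆ U} (Hyperspace.isOpen_setOf_subset hU)
    ⟨⟨{x}, isClosed_singleton, Set.singleton_nonempty x⟩, Set.singleton_subset_iff.2 hx⟩
  obtain ⟨b, hb⟩ := B.2.2
  refine ⟨b, mem_interior.2
    ⟨B.insertPoint ⁻¹' interior (hyperMap hc '' {A | A.1 ⊆ U}), ?_,
      isOpen_interior.preimage B.continuous_insertPoint, ?_⟩⟩
  · intro y hy
    obtain ⟨A, hA, hAy⟩ := interior_subset hy
    have hyA : y ∈ (hyperMap hc A).1 := by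
      rw [hAy]
      exact Set.mem_insert y B.1
    exact Set.image_mono hA hyA
  · have hbB : B.insertPoint b = B := Subtype.ext (Set.insert_eq_of_mem hb)
    rw [Set.mem_preimage, hbB]
    exact hB
end

section
/- Let π : X → Y be a continuous surjection between compact Hausdorff spaces and let X₀ denote the set of injectivity points of π. Then every finite convex combination μ = Σᵢ αᵢ δ_{xᵢ} of Dirac measures at points x₁, …, xₙ ∈ X₀ is an injectivity point of the push-forward map M(π) : M(X) → M(Y); that is, if ν ∈ M(X) satisfies π_*ν = π_*μ, then ν = μ. -/
open MeasureTheory Set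

/-- A set of injectivity points is saturated. -/
theorem preimage_image_eq_of_isInjectivityPoint {X Y : Type*} {π : X → Y} {s : Set X}
    (hs : ∀ x ∈ s, IsInjectivityPoint π x) : π ⁻¹' (π '' s) = s := by
  refine Subset.antisymm ?_ (subset_preimage_image π s)
  rintro z ⟨y, hy, hyz⟩
  have hz : z ∈ π ⁻¹' {π y} := hyz.symm
  rw [hs y hy] at hz
  rwa [mem_singleton_iff.1 hz]

/-- Two measures with the same push-forward coincide if one of them, hence also the other, is
concentrated on a finite set of injectivity points. -/
theorem measure_eq_of_map_eq_of_finite_isInjectivityPoint {X Y : Type*}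
    [MeasurableSpace X] [MeasurableSpace Y] [MeasurableSingletonClass Y] {π : X → Y}
    (hπ : Measurable π) {s : Set X} (hfin : s.Finite)
    (hs : ∀ x ∈ s, IsInjectivityPoint π x) {μ ν : Measure X}
    (hμ : μ sᶜ = 0) (hν : ν.map π = μ.map π) : ν = μ := by
  have key (t : Set Y) (ht : MeasurableSet t) : ν (π ⁻¹' t) = μ (π ⁻¹' t) := by
    rw [← Measure.map_apply hπ ht, hν, Measure.map_apply hπ ht]
  have hνs : ν sᶜ = 0 := by
    have h := key _ (hfin.image π).measurableSet.compl
    rwa [preimage_compl, preimage_image_eq_of_isInjectivityPoint hs, hμ] at h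
  ext A -
  rw [← measure_inter_conull hνs, ← measure_inter_conull hμ,
    ← preimage_image_eq_of_isInjectivityPoint fun x hx => hs x (inter_subset_right hx)]
  exact key _ ((hfin.subset inter_subset_right).image π).measurableSet

theorem stmt_7 {X Y : Type*} [TopologicalSpace X] [CompactSpace X] [T2Space X]
    [TopologicalSpace Y] [CompactSpace Y] [T2Space Y] [MeasurableSpace X] [BorelSpace X] [MeasurableSpace Y] [BorelSpace Y]
    (π : X → Y) (hc : Continuous π) (hs : Function.Surjective π)
    (n : ℕ) (x : Fin n → X) (hx : ∀ i, IsInjectivityPoint π (x i))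
    (α : Fin n → NNReal) (hα : ∑ i, α i = 1)
    (μ : ProbabilityMeasure X)
    (hμ : (μ : Measure X) = ∑ i, (α i : ENNReal) • MeasureTheory.Measure.dirac (x i))
    (ν : ProbabilityMeasure X)
    (hν : pushforwardMap hc ν = pushforwardMap hc μ) :
    ν = μ := by
  refine Subtype.ext (measure_eq_of_map_eq_of_finite_isInjectivityPoint hc.measurable
    (finite_range x) (forall_mem_range.2 hx) ?_ (congrArg Subtype.val hν))
  change (μ : Measure X) _ = 0
  rw [hμ]
  simp [Measure.dirac_apply' _ (finite_range x).measurableSet.compl]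
end

section
/- Let φ : X → Y and ψ : Y → Z be continuous surjections between compact Hausdorff spaces and let π := ψ ∘ φ. If π is almost one-to-one, then both φ and ψ are almost one-to-one. -/
open MeasureTheory Set

theorem IsInjectivityPoint.of_comp {X Y Z : Type*} {φ : X → Y} {ψ : Y → Z} {x : X}
    (h : IsInjectivityPoint (ψ ∘ φ) x) : IsInjectivityPoint φ x :=
  Subset.antisymm (fun _ hw => h.subset (congrArg ψ hw)) (by simp)

theorem IsInjectivityPoint.map_of_comp {X Y Z : Type*} {φ : X → Y} {ψ : Y → Z} {x : X}
    (hφ : Function.Surjective φ) (h : IsInjectivityPoint (ψ ∘ φ) x) :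
    IsInjectivityPoint ψ (φ x) := by
  refine Subset.antisymm (fun y hy => ?_) (by simp)
  obtain ⟨w, rfl⟩ := hφ y
  exact congrArg φ (h.subset hy)

theorem stmt_15 {X Y Z : Type*} [TopologicalSpace X] [CompactSpace X] [T2Space X]
    [TopologicalSpace Y] [CompactSpace Y] [T2Space Y]
    [TopologicalSpace Z] [CompactSpace Z] [T2Space Z]
    (φ : X → Y) (ψ : Y → Z) (hφc : Continuous φ) (hφs : Function.Surjective φ)
    (hψc : Continuous ψ) (hψs : Function.Surjective ψ) (h : IsAlmostOneToOne (ψ ∘ φ)) :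
    IsAlmostOneToOne φ ∧ IsAlmostOneToOne ψ := by
  refine ⟨h.mono fun _ => IsInjectivityPoint.of_comp,
    (hφs.denseRange.dense_image hφc h).mono ?_⟩
  rintro _ ⟨x, hx, rfl⟩
  exact IsInjectivityPoint.map_of_comp hφs hx
end
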